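/- Let x ∈ D ⊆ 𝒟 with E_f(x) ∈ J satisfy ‖x − T(x)‖ ⪯ γ(E_f(x))·‖W_f(x)‖, where γ : J → ℝ₊ is such that ψ(t) = 1 − b·t·γ(t) is positive on J, and let μ(t) = 1 − t·γ(t). Then, writing x̂ = T(x), for all i and all j ≠ i one has |x̂_i − x_j| ≥ μ(E_f(x))·d_j(x) > 0. (Theorem 2.1 (iii)) -/

import Mathlib

open Finset Polynomial Filter

noncomputable section

/-- The Weierstrass correction `W_i(x) = f(x_i)/(C₀ ∏_{j≠i}(x_i − x_j))`. -/
def Wc {n : ℕ} {K : Type*} [NormedField K] (f : Polynomial K) (x : Fin n → K) (i : Fin n) : K :=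
  eval (x i) f / (f.leadingCoeff * ∏ j ∈ univ.erase i, (x i - x j))

/-- `dmin x i = min_{j ≠ i} ‖x i - x j‖`. -/
def dmin {n : ℕ} {K : Type*} [NormedField K] (x : Fin n → K) (i : Fin n) : ℝ :=
  if h : (univ.erase i).Nonempty then (univ.erase i).inf' h fun j => ‖x i - x j‖ else 0

/-- `E_f(x)` : the ℓ^p norm of the vector `(‖W_i(x)‖ / d_i(x))_i`. -/
def Ef {n : ℕ} {K : Type*} [NormedField K] (p : ENNReal) (f : Polynomial K)
    (x : Fin n → K) : ℝ :=
  ‖(WithLp.equiv p (Fin n → ℝ)).symm (fun i => ‖Wc f x i‖ / dmin x i)‖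

/-- `σ_i(x) = Σ_{j≠i} W_j(x)/(x_i − x_j)`. -/
def sigmaf {n : ℕ} {K : Type*} [NormedField K] (f : Polynomial K) (x : Fin n → K)
    (i : Fin n) : K :=
  ∑ j ∈ univ.erase i, Wc f x j / (x i - x j)

/-- The Ehrlich iteration function. -/
def PhiE {n : ℕ} {K : Type*} [NormedField K] (f : Polynomial K) (x : Fin n → K) : Fin n → K :=
  fun i => x i - Wc f x i / (1 + sigmaf f x i)

/-- The Prešić–Tanabe iteration function. -/
def TnbE {n : ℕ} {K : Type*} [NormedField K] (f : Polynomial K) (x : Fin n → K) : Fin n → K :=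
  fun i => x i - Wc f x i * (1 - sigmaf f x i)

/-- `ξ` is a root vector of `f`, i.e. `f(z) = C₀ ∏ (z − ξᵢ)`. -/
def IsRootVector {n : ℕ} {K : Type*} [NormedField K] (f : Polynomial K) (ξ : Fin n → K) : Prop :=
  f = C f.leadingCoeff * ∏ i, (X - C (ξ i))

/-- `E_f(x)` in the case `p = ∞`: the max of `‖W_i(x)‖ / d_i(x)`. -/
def Einf {n : ℕ} {K : Type*} [NormedField K] (f : Polynomial K) (x : Fin n → K) : ℝ :=
  if h : (univ : Finset (Fin n)).Nonempty then univ.sup' h fun i => ‖Wc f x i‖ / dmin x i else 0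

theorem dmin_le {n : ℕ} {K : Type*} [NormedField K] (x : Fin n → K) {i j : Fin n}
    (hij : j ≠ i) : dmin x i ≤ ‖x i - x j‖ := by
  have hj : j ∈ univ.erase i := mem_erase.2 ⟨hij, mem_univ j⟩
  have hne : (univ.erase i).Nonempty := ⟨j, hj⟩
  rw [dmin, dif_pos hne]
  exact inf'_le _ hj

theorem dmin_pos {n : ℕ} {K : Type*} [NormedField K] {x : Fin n → K}
    (hx : Function.Injective x) {i j : Fin n} (hij : j ≠ i) : 0 < dmin x i := by
  have hj : j ∈ univ.erase i := mem_erase.2 ⟨hij, mem_univ j⟩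
  have hne : (univ.erase i).Nonempty := ⟨j, hj⟩
  rw [dmin, dif_pos hne]
  refine (lt_inf'_iff _).2 fun k hk => ?_
  exact norm_pos_iff.2 (sub_ne_zero.2 fun h => (mem_erase.1 hk).1 (hx h).symm)

theorem norm_Wc_div_dmin_le_Ef {n : ℕ} {K : Type*} [NormedField K] {p : ENNReal} (hp : 1 ≤ p)
    (f : Polynomial K) (x : Fin n → K) (i : Fin n) : ‖Wc f x i‖ / dmin x i ≤ Ef p f x := by
  have : Fact (1 ≤ p) := ⟨hp⟩
  exact (le_abs_self _).trans (PiLp.norm_apply_le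
    (WithLp.toLp p fun i => ‖Wc f x i‖ / dmin x i : PiLp p fun _ : Fin n => ℝ) i)

/-- Proinov, Theorem 2.1 (iii). -/
theorem stmt_1 {n : ℕ} {K : Type*} [NormedField K] [CompleteSpace K] (hn : 2 ≤ n)
    (f : Polynomial K) (hdeg : f.degree = (n : ℕ))
    (p q : ENNReal) (hp : 1 ≤ p) (hpq : p⁻¹ + q⁻¹ = 1)
    (b : ℝ) (hb : b = (2 : ℝ) ^ (ENNReal.toReal q⁻¹))
    (J : Set ℝ) (hJ0 : (0 : ℝ) ∈ J) (hJsub : J ⊆ Set.Ici (0 : ℝ)) (hJconn : J.OrdConnected)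
    (γ : ℝ → ℝ) (hγ : ∀ t ∈ J, 0 ≤ γ t) (hψ : ∀ t ∈ J, 0 < 1 - b * t * γ t)
    (D : Set (Fin n → K)) (hD : ∀ y ∈ D, Function.Injective y)
    (T : (Fin n → K) → Fin n → K)
    (x : Fin n → K) (hxD : x ∈ D) (hxE : Ef p f x ∈ J)
    (hmain : ∀ i, ‖x i - T x i‖ ≤ γ (Ef p f x) * ‖Wc f x i‖) :
    ∀ i j : Fin n, j ≠ i →
      0 < (1 - Ef p f x * γ (Ef p f x)) * dmin x j ∧
      (1 - Ef p f x * γ (Ef p f x)) * dmin x j ≤ ‖T x i - x j‖ := by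
  intro i j hij
  have hinj := hD x hxD
  set E := Ef p f x
  have hE : 0 ≤ E := hJsub hxE
  have hg : 0 ≤ γ E := hγ E hxE
  have hb1 : 1 ≤ b := hb ▸ Real.one_le_rpow one_le_two ENNReal.toReal_nonneg
  have hμ : 0 < 1 - E * γ E := by
    nlinarith [hψ E hxE, mul_le_mul_of_nonneg_right hb1 (mul_nonneg hE hg)]
  refine ⟨mul_pos hμ (dmin_pos hinj hij.symm), ?_⟩
  have hW : ‖Wc f x i‖ ≤ E * ‖x i - x j‖ :=
    ((div_le_iff₀ (dmin_pos hinj hij)).1 (norm_Wc_div_dmin_le_Ef hp f x i)).trans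
      (mul_le_mul_of_nonneg_left (dmin_le x hij) hE)
  have hd : dmin x j ≤ ‖x i - x j‖ := norm_sub_rev (x i) (x j) ▸ dmin_le x hij.symm
  have htri : ‖x i - x j‖ ≤ ‖x i - T x i‖ + ‖T x i - x j‖ := norm_sub_le_norm_sub_add_norm_sub _ _ _
  calc (1 - E * γ E) * dmin x j ≤ (1 - E * γ E) * ‖x i - x j‖ := by gcongr
    _ = ‖x i - x j‖ - γ E * (E * ‖x i - x j‖) := by ring
    _ ≤ ‖x i - x j‖ - γ E * ‖Wc f x i‖ := by gcongr
    _ ≤ ‖T x i - x j‖ := by linarith [hmain i]
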